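/- arXiv:0906.2488 — 11 statements merged into one kernel-verified Lean document; each statement's English description precedes it below -/
import Mathlib

section
/- Let A be an n×n symmetric matrix over the field F₂ = ZMod 2 with all diagonal entries equal to 0, and let m be the rank of A over F₂. Then m is even, and there exists an m×n matrix C over F₂ of rank m such that A = Cᵀ·N_m·C, where N_m is the m×m block-diagonal matrix consisting of m/2 diagonal blocks equal to [[0,1],[1,0]]. -/
/-- The `m × m` block-diagonal matrix over `F₂` consisting of `m/2` diagonal
blocks equal to `[[0,1],[1,0]]`. -/
def pairSwapBlocks (m : ℕ) : Matrix (Fin m) (Fin m) (ZMod 2) :=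
  Matrix.of fun i j => if i.val / 2 = j.val / 2 ∧ i.val ≠ j.val then 1 else 0

/-- Subtracting the hyperbolic part spanned by rows `p` and `q` with `A p q = 1` from a symmetric
zero-diagonal matrix lowers the rank by at least two. -/
theorem rank_sub_hyperbolic_add_two_le {ι : Type*} [Fintype ι] [DecidableEq ι]
    {A : Matrix ι ι (ZMod 2)} (hsymm : A.IsSymm) (hdiag : ∀ i, A i i = 0) {p q : ι}
    (hpq : A p q = 1) :
    (A - Matrix.vecMulVec (A p) (A q) - Matrix.vecMulVec (A q) (A p)).rank + 2 ≤ A.rank := by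
  set B := A - Matrix.vecMulVec (A p) (A q) - Matrix.vecMulVec (A q) (A p) with hB
  have hcol (j : ι) : A.mulVec (Pi.single j 1) = A j := by
    ext i
    simp [hsymm.apply j i]
  have hBx (x : ι → ZMod 2) : B.mulVec x = A.mulVec
      (x - (A q ⬝ᵥ x) • Pi.single p 1 - (A p ⬝ᵥ x) • Pi.single q 1) := by
    simp [hB, Matrix.sub_mulVec, Matrix.mulVec_sub, Matrix.mulVec_smul, hcol,
      Matrix.vecMulVec_mulVec]
  have hqp : A q p = 1 := by rw [hsymm.apply, hpq]
  have hrow (x : ι → ZMod 2) : B.mulVec x p = 0 ∧ B.mulVec x q = 0 := by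
    constructor <;>
      simp [hB, Matrix.vecMulVec_apply, hdiag, hpq, hqp, Matrix.mulVec, dotProduct]
  let S := LinearMap.range A.mulVecLin ⊓
    LinearMap.ker (LinearMap.proj p : (ι → ZMod 2) →ₗ[ZMod 2] ZMod 2)
  have hmem (j : ι) : A j ∈ LinearMap.range A.mulVecLin := ⟨Pi.single j 1, by simp [hcol]⟩
  have h₁ : LinearMap.range B.mulVecLin < S := by
    refine SetLike.lt_iff_le_and_exists.2 ⟨?_, A p, Submodule.mem_inf.2 ⟨hmem p, hdiag p⟩, ?_⟩
    · rintro _ ⟨x, rfl⟩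
      exact ⟨⟨_, (hBx x).symm⟩, (hrow x).1⟩
    · rintro ⟨x, hx⟩
      have := (hrow x).2
      rw [← Matrix.mulVecLin_apply, hx, hpq] at this
      exact one_ne_zero this
  have h₂ : S < LinearMap.range A.mulVecLin := by
    refine SetLike.lt_iff_le_and_exists.2 ⟨inf_le_left, A q, hmem q, fun h => ?_⟩
    have : A q p = 0 := h.2
    exact one_ne_zero (hqp.symm.trans this)
  have h₁' := Submodule.finrank_lt_finrank_of_lt h₁
  have h₂' := Submodule.finrank_lt_finrank_of_lt h₂
  simp only [Matrix.rank]
  omega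

/-- Appending two rows to `C` adds a hyperbolic term to `Cᵀ * pairSwapBlocks m * C`. -/
theorem transpose_mul_pairSwapBlocks_mul_snoc {ι : Type*} {m : ℕ} (hm : Even m)
    (C : Matrix (Fin m) ι (ZMod 2)) (a b : ι → ZMod 2) :
    let D : Matrix (Fin (m + 2)) ι (ZMod 2) :=
      Matrix.of (Fin.snoc (Fin.snoc (α := fun _ => ι → ZMod 2) C a) b)
    D.transpose * pairSwapBlocks (m + 2) * D =
      C.transpose * pairSwapBlocks m * C + Matrix.vecMulVec a b + Matrix.vecMulVec b a := by
  intro D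
  obtain ⟨k, rfl⟩ := hm
  have hlt (s : Fin (k + k)) : s.val / 2 ≠ (k + k) / 2 := by omega
  have hk : (k + k + 1) / 2 = (k + k) / 2 := by omega
  have hC (s : Fin (k + k)) : D s.castSucc.castSucc = C s :=
    (Fin.snoc_castSucc (α := fun _ => ι → ZMod 2) ..).trans (Fin.snoc_castSucc ..)
  have ha : D (Fin.last (k + k)).castSucc = a :=
    (Fin.snoc_castSucc (α := fun _ => ι → ZMod 2) ..).trans (Fin.snoc_last ..)
  have hb : D (Fin.last (k + k + 1)) = b := Fin.snoc_last (α := fun _ => ι → ZMod 2) ..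
  ext i j
  simp [Matrix.mul_apply, Fin.sum_univ_castSucc, pairSwapBlocks, Matrix.vecMulVec_apply, hC, ha,
    hb, hlt, (hlt _).symm, hk]
  ring

theorem exists_transpose_mul_pairSwapBlocks_mul {ι : Type*} [Fintype ι] [DecidableEq ι]
    (A : Matrix ι ι (ZMod 2)) (hsymm : A.IsSymm) (hdiag : ∀ i, A i i = 0) :
    ∃ m, Even m ∧ m ≤ A.rank ∧ ∃ C : Matrix (Fin m) ι (ZMod 2),
      A = C.transpose * pairSwapBlocks m * C := by
  induction hr : A.rank using Nat.strong_induction_on generalizing A with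
  | _ r ih =>
    by_cases hA : A = 0
    · exact ⟨0, Even.zero, Nat.zero_le _, 0, by simp [hA]⟩
    obtain ⟨p, q, hpq⟩ : ∃ p q, A p q ≠ 0 := by
      by_contra! h
      exact hA (Matrix.ext h)
    have hpq : A p q = 1 := Fin.eq_one_of_ne_zero _ hpq
    have hrank := rank_sub_hyperbolic_add_two_le hsymm hdiag hpq
    obtain ⟨m, hm, hmr, C, hC⟩ := ih _ (by omega)
      (A - Matrix.vecMulVec (A p) (A q) - Matrix.vecMulVec (A q) (A p))
      (by
        ext i j
        simp only [Matrix.transpose_apply, Matrix.sub_apply, Matrix.vecMulVec_apply,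
          hsymm.apply i j]
        ring)
      (fun i => by
        simp only [Matrix.sub_apply, Matrix.vecMulVec_apply, hdiag, mul_comm (A q i)]
        rw [sub_sub, CharTwo.add_self_eq_zero, sub_zero]) rfl
    refine ⟨m + 2, hm.add even_two, by omega, _,
      Eq.trans ?_ (transpose_mul_pairSwapBlocks_mul_snoc hm C (A p) (A q)).symm⟩
    rw [← hC]
    abel

theorem rank_decomposition_of_symm_zero_diag {n : ℕ}
    (A : Matrix (Fin n) (Fin n) (ZMod 2)) (hsymm : A.IsSymm)
    (hdiag : ∀ i, A i i = 0) (m : ℕ) (hm : A.rank = m) :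
    Even m ∧ ∃ C : Matrix (Fin m) (Fin n) (ZMod 2),
      C.rank = m ∧ A = C.transpose * pairSwapBlocks m * C := by
  obtain ⟨k, hk, hkr, C, hC⟩ := exists_transpose_mul_pairSwapBlocks_mul A hsymm hdiag
  have hAC : A.rank ≤ C.rank := (congrArg Matrix.rank hC).trans_le (Matrix.rank_mul_le_right _ _)
  have hCk : C.rank ≤ k := C.rank_le_height
  obtain rfl : k = m := by omega
  exact ⟨hk, C, by omega, hC⟩
end

section
/- Let G be a finite simple graph on n vertices, let m ≥ 1 be odd, let T be an m×n matrix over F₂ of rank m, let c ∈ F₂^m and z ∈ F₂. Suppose that for every x ∈ F₂^n, writing y = T·x + c, one has f_G(x) = y₁ + y₂y₃ + y₄y₅ + … + y_{m-1}y_m + z (a readonce form of Type I). Then the binary rank of G equals m − 1. -/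
/-- The quadratic Boolean form associated with a graph `G`:
`f_G(x) = ∑_{{i,j} ∈ E(G)} x_i x_j` over `F₂ = ZMod 2`. -/
noncomputable def quadForm {V : Type*} [Fintype V] (G : SimpleGraph V)
    (x : V → ZMod 2) : ZMod 2 := by
  classical
  exact ∑ e ∈ G.edgeFinset,
    Sym2.lift ⟨fun i j => x i * x j, fun a b => mul_comm (x a) (x b)⟩ e

/-- The MS-number `w(G)`: the number of `x ∈ F₂^V` with `f_G(x) = 1`. -/
noncomputable def msNumber {V : Type*} [Fintype V] (G : SimpleGraph V) : ℕ := by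
  classical
  exact (Finset.univ.filter fun x : V → ZMod 2 => quadForm G x = 1).card

/-- The binary rank of a graph: the rank of its adjacency matrix over `F₂`. -/
noncomputable def brank {V : Type*} [Fintype V] [DecidableEq V]
    (G : SimpleGraph V) : ℕ := by
  classical
  exact (SimpleGraph.adjMatrix (ZMod 2) G).rank

/-- Extend a vector indexed by `Fin m` to one indexed by `ℕ` (zero elsewhere). -/
def extendVec {m : ℕ} (v : Fin m → ZMod 2) : ℕ → ZMod 2 :=
  fun k => if h : k < m then v ⟨k, h⟩ else 0

/-- The readonce form of Type I in `m` variables (`m` odd), `0`-indexed: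
`g(y) = y₁ + y₂y₃ + y₄y₅ + … + y_{m-1}y_m + z` (where `y₁,…,y_m` is `1`-indexed). -/
def typeI (m : ℕ) (y : ℕ → ZMod 2) (z : ZMod 2) : ZMod 2 :=
  y 0 + (∑ k ∈ Finset.range ((m - 1) / 2), y (2 * k + 1) * y (2 * k + 2)) + z

/-- The readonce form of Type II in `m` variables (`m` even), `0`-indexed:
`g(y) = y₁y₂ + y₃y₄ + … + y_{m-1}y_m + z` (where `y₁,…,y_m` is `1`-indexed). -/
def typeII (m : ℕ) (y : ℕ → ZMod 2) (z : ZMod 2) : ZMod 2 :=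
  (∑ k ∈ Finset.range (m / 2), y (2 * k) * y (2 * k + 1)) + z

open Matrix

/-- The polarization of the quadratic form of a graph is the bilinear form of its adjacency
matrix. -/
theorem quadForm_polar {V : Type*} [Fintype V] (G : SimpleGraph V) [DecidableRel G.Adj]
    (x y : V → ZMod 2) :
    quadForm G (x + y) + quadForm G x + quadForm G y = x ⬝ᵥ (G.adjMatrix (ZMod 2) *ᵥ y) := by
  classical
  have hpairs : x ⬝ᵥ (G.adjMatrix (ZMod 2) *ᵥ y) =
      ∑ p : V × V with G.Adj p.1 p.2, x p.1 * y p.2 := by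
    simp only [dotProduct, mulVec, SimpleGraph.adjMatrix_apply, Finset.mul_sum, Finset.sum_filter,
      Fintype.sum_prod_type, ite_mul, one_mul, zero_mul, mul_ite, mul_zero]
  rw [hpairs, ← Finset.sum_fiberwise_of_maps_to (t := G.edgeFinset)
    (g := fun p : V × V => s(p.1, p.2)) (by simp)]
  simp only [quadForm]
  rw [← Finset.sum_add_distrib, ← Finset.sum_add_distrib]
  refine Finset.sum_congr (by congr!) fun e he => ?_
  induction e with | _ a b =>
  have hab : G.Adj a b := by simpa using he
  have hfiber : ({p ∈ ({p : V × V | G.Adj p.1 p.2} : Finset _) | s(p.1, p.2) = s(a, b)} :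
      Finset (V × V)) = {(a, b), (b, a)} := by
    ext ⟨i, j⟩
    simp only [Finset.mem_filter, Finset.mem_univ, true_and, Sym2.eq_iff, Finset.mem_insert,
      Finset.mem_singleton, Prod.mk.injEq]
    constructor
    · exact fun hp => hp.2
    · rintro (⟨rfl, rfl⟩ | ⟨rfl, rfl⟩)
      · exact ⟨hab, .inl ⟨rfl, rfl⟩⟩
      · exact ⟨hab.symm, .inr ⟨rfl, rfl⟩⟩
  rw [hfiber, Finset.sum_pair (by simp [hab.ne])]
  simp only [Sym2.lift_mk, Pi.add_apply]
  linear_combination (x a * x b + y a * y b) * CharTwo.two_eq_zero (R := ZMod 2)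

theorem quadForm_zero {V : Type*} [Fintype V] (G : SimpleGraph V) : quadForm G 0 = 0 := by
  classical
  refine Finset.sum_eq_zero fun e _ => ?_
  induction e with | _ a b => simp

theorem extendVec_add {m : ℕ} (u v : Fin m → ZMod 2) :
    extendVec (u + v) = extendVec u + extendVec v := by
  ext k
  by_cases hk : k < m <;> simp [extendVec, hk]

theorem extendVec_apply_of_lt {m k : ℕ} (v : Fin m → ZMod 2) (hk : k < m) :
    extendVec v k = v ⟨k, hk⟩ := dif_pos hk

theorem extendVec_single {m : ℕ} (j : Fin m) :
    extendVec (Pi.single j 1) = Pi.single (j : ℕ) 1 := by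
  ext k
  by_cases hk : k < m
  · simp [extendVec, hk, Pi.single_apply, Fin.ext_iff]
  · have : k ≠ j := by omega
    simp [extendVec, hk, this]

theorem typeI_polar (m : ℕ) (u v c : ℕ → ZMod 2) (z : ZMod 2) :
    typeI m (u + v + c) z + typeI m (u + c) z + typeI m (v + c) z + typeI m c z =
      ∑ k ∈ Finset.range ((m - 1) / 2),
        (u (2 * k + 1) * v (2 * k + 2) + u (2 * k + 2) * v (2 * k + 1)) := by
  have h2 := CharTwo.two_eq_zero (R := ZMod 2)
  have hsum : ∑ k ∈ Finset.range ((m - 1) / 2),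
        ((u + v + c) (2 * k + 1) * (u + v + c) (2 * k + 2)
          + (u + c) (2 * k + 1) * (u + c) (2 * k + 2)
          + (v + c) (2 * k + 1) * (v + c) (2 * k + 2) + c (2 * k + 1) * c (2 * k + 2)) =
      ∑ k ∈ Finset.range ((m - 1) / 2),
        (u (2 * k + 1) * v (2 * k + 2) + u (2 * k + 2) * v (2 * k + 1)) := by
    refine Finset.sum_congr rfl fun k _ => ?_
    simp only [Pi.add_apply]
    generalize u (2 * k + 1) = a, u (2 * k + 2) = b, v (2 * k + 1) = d, v (2 * k + 2) = e,
      c (2 * k + 1) = f, c (2 * k + 2) = g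
    revert a b d e f g
    decide
  rw [← hsum]
  simp only [typeI, Finset.sum_add_distrib, Pi.add_apply]
  linear_combination (u 0 + v 0 + 2 * c 0 + 2 * z) * h2

/-- A vector is in the radical of the polarization of a Type I form iff all its coordinates but
the first vanish. -/
theorem typeI_polar_eq_zero_iff {m : ℕ} (hodd : Odd m) (v : Fin m → ZMod 2) :
    (∀ u : Fin m → ZMod 2, ∑ k ∈ Finset.range ((m - 1) / 2),
        (extendVec u (2 * k + 1) * extendVec v (2 * k + 2) +
          extendVec u (2 * k + 2) * extendVec v (2 * k + 1)) = 0) ↔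
      ∀ i : Fin m, (i : ℕ) ≠ 0 → v i = 0 := by
  constructor
  · intro hu i hi
    obtain ⟨p, rfl⟩ := hodd
    obtain ⟨k, hk | hk⟩ : ∃ k, (i : ℕ) = 2 * k + 1 ∨ (i : ℕ) = 2 * k + 2 :=
      ⟨(i - 1) / 2, by omega⟩
    · have := hu (Pi.single ⟨2 * k + 2, by omega⟩ 1)
      rw [Finset.sum_eq_single_of_mem k (by simp; omega)] at this
      · simpa [extendVec_single, Pi.single_apply, ← hk, extendVec_apply_of_lt v i.isLt,
          show (i : ℕ) ≠ 2 * k + 2 by omega] using this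
      · intro l _ hl
        have h1 : 2 * l ≠ 2 * k + 1 := by omega
        simp [extendVec_single, h1, hl]
    · have := hu (Pi.single ⟨2 * k + 1, by omega⟩ 1)
      rw [Finset.sum_eq_single_of_mem k (by simp; omega)] at this
      · simpa [extendVec_single, Pi.single_apply, ← hk, extendVec_apply_of_lt v i.isLt,
          show (i : ℕ) ≠ 2 * k + 1 by omega] using this
      · intro l _ hl
        have h1 : 2 * l + 2 ≠ 2 * k + 1 := by omega
        simp [extendVec_single, h1, hl]
  · intro hv u
    have hext : ∀ k, k ≠ 0 → extendVec v k = 0 := fun k hk => by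
      by_cases hkm : k < m
      · rw [extendVec_apply_of_lt v hkm, hv _ hk]
      · exact dif_neg hkm
    exact Finset.sum_eq_zero fun k _ => by simp [hext]

theorem Matrix.rank_eq_of_mulVec_eq_zero_iff {K l m n : Type*} [Field K] [Fintype n]
    (A : Matrix l n K) (B : Matrix m n K) (h : ∀ x, A.mulVec x = 0 ↔ B.mulVec x = 0) :
    A.rank = B.rank := by
  have hker : LinearMap.ker A.mulVecLin = LinearMap.ker B.mulVecLin := by
    ext x; simpa using h x
  have hA := A.mulVecLin.finrank_range_add_finrank_ker
  have hB := B.mulVecLin.finrank_range_add_finrank_ker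
  rw [hker] at hA
  exact Nat.add_right_cancel (hA.trans hB.symm)

theorem brank_eq_of_typeI {n m : ℕ} (G : SimpleGraph (Fin n))
    (hm : 1 ≤ m) (hodd : Odd m)
    (T : Matrix (Fin m) (Fin n) (ZMod 2)) (hT : T.rank = m)
    (c : Fin m → ZMod 2) (z : ZMod 2)
    (h : ∀ x : Fin n → ZMod 2,
      quadForm G x = typeI m (extendVec (T.mulVec x + c)) z) :
    brank G = m - 1 := by
  classical
  obtain ⟨m, rfl⟩ : ∃ p, m = p + 1 := ⟨m - 1, by omega⟩
  have hsurj : Function.Surjective T.mulVec := by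
    have : LinearMap.range T.mulVecLin = ⊤ :=
      Submodule.eq_top_of_finrank_eq (by simpa [Matrix.rank] using hT)
    exact LinearMap.range_eq_top.1 this
  have hrows : LinearIndependent (ZMod 2) T.row := by
    rw [linearIndependent_iff_card_eq_finrank_span, Set.finrank, ← T.rank_eq_finrank_span_row, hT,
      Fintype.card_fin]
  have hrank : (T.submatrix Fin.succ id).rank = m := by
    have hsub : LinearIndependent (ZMod 2) (T.submatrix Fin.succ id).row :=
      hrows.comp Fin.succ (Fin.succ_injective m)
    rw [hsub.rank_matrix, Fintype.card_fin]
  have hpolar : ∀ x y : Fin n → ZMod 2, x ⬝ᵥ (G.adjMatrix (ZMod 2) *ᵥ y) =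
      ∑ k ∈ Finset.range ((m + 1 - 1) / 2),
        (extendVec (T *ᵥ x) (2 * k + 1) * extendVec (T *ᵥ y) (2 * k + 2) +
          extendVec (T *ᵥ x) (2 * k + 2) * extendVec (T *ᵥ y) (2 * k + 1)) := fun x y => by
    rw [← quadForm_polar, ← typeI_polar _ _ _ (extendVec c) z, ← add_zero (_ + quadForm G y),
      ← quadForm_zero G]
    simp only [h, mulVec_add, mulVec_zero, extendVec_add, zero_add]
  suffices hA : (G.adjMatrix (ZMod 2)).rank = (T.submatrix Fin.succ id).rank by
    rw [Nat.add_sub_cancel, ← hrank, ← hA]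
    simp only [brank]
  refine rank_eq_of_mulVec_eq_zero_iff _ _ fun y => ?_
  calc G.adjMatrix (ZMod 2) *ᵥ y = 0
      ↔ ∀ x, x ⬝ᵥ (G.adjMatrix (ZMod 2) *ᵥ y) = 0 := by
        simp only [dotProduct_comm _ (_ *ᵥ y), dotProduct_eq_zero_iff]
    _ ↔ ∀ i : Fin (m + 1), (i : ℕ) ≠ 0 → (T *ᵥ y) i = 0 := by
        rw [← typeI_polar_eq_zero_iff hodd, hsurj.forall]
        simp only [hpolar]
    _ ↔ T.submatrix Fin.succ id *ᵥ y = 0 := by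
        simp [Fin.forall_fin_succ, funext_iff, mulVec, dotProduct]
end

section
/- Let G be a finite simple graph on n vertices with at least one edge, and let r be the binary rank of G (which is even and positive). Then exactly one of the following holds: w(G) = 2^{n-1}, or w(G) = 2^{n-1} − 2^{n-1-r/2}, or w(G) = 2^{n-1} + 2^{n-1-r/2}. -/
/-- The nontrivial character of `ZMod 2`, with integer values `±1`. -/
def signChar : AddChar (ZMod 2) ℤ where
  toFun a := if a = 0 then 1 else -1
  map_zero_eq_one' := rfl
  map_add_eq_mul' := by decide

theorem signChar_apply (a : ZMod 2) : signChar a = if a = 0 then 1 else -1 := rfl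

theorem sum_signChar_comp {H : Type*} [AddCommGroup H] [Fintype H] (φ : H →+ ZMod 2)
    [Decidable (φ = 0)] :
    ∑ h, signChar (φ h) = if φ = 0 then (Fintype.card H : ℤ) else 0 := by
  classical
  have key : signChar.compAddMonoidHom φ = 0 ↔ φ = 0 := by
    constructor
    · intro h
      ext x
      have hx : signChar (φ x) = 1 := DFunLike.congr_fun h x
      have : ∀ a : ZMod 2, signChar a = 1 → a = 0 := by
        intro a
        rw [signChar_apply]
        revert a
        decide
      exact this _ hx
    · rintro rfl
      ext x
      simp
  have h := AddChar.sum_eq_ite (signChar.compAddMonoidHom φ)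
  simp only [key] at h
  exact h

theorem card_ker_mulVecLin {V : Type*} [Fintype V] (A : Matrix V V (ZMod 2))
    [Fintype (LinearMap.ker A.mulVecLin)] :
    Fintype.card (LinearMap.ker A.mulVecLin) = 2 ^ (Fintype.card V - A.rank) := by
  have h := A.mulVecLin.finrank_range_add_finrank_ker
  rw [Module.finrank_fintype_fun_eq_card] at h
  rw [Module.card_eq_pow_finrank (K := ZMod 2), ZMod.card, Matrix.rank]
  congr 1
  omega

section QuadraticForm

variable {V : Type*} [Fintype V] [DecidableEq V]

theorem sum_signChar_dotProduct (v : V → ZMod 2) :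
    ∑ x : V → ZMod 2, signChar (x ⬝ᵥ v) = if v = 0 then 2 ^ Fintype.card V else 0 := by
  classical
  let φ : (V → ZMod 2) →+ ZMod 2 :=
    { toFun := fun x => x ⬝ᵥ v
      map_zero' := zero_dotProduct v
      map_add' := fun x y => add_dotProduct x y v }
  have hφ : φ = 0 ↔ v = 0 := by
    constructor
    · intro h
      ext i
      have := DFunLike.congr_fun h (Pi.single i 1)
      simpa [φ] using this
    · rintro rfl
      ext x
      simp [φ]
  have h := sum_signChar_comp φ
  simp only [hφ] at h
  simpa [φ, ZMod.card] using h

variable {A : Matrix V V (ZMod 2)} {f : (V → ZMod 2) → ZMod 2}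

theorem sq_sum_signChar [Fintype (LinearMap.ker A.mulVecLin)]
    (hf : ∀ x y, f (x + y) = f x + f y + x ⬝ᵥ A.mulVec y) :
    (∑ x, signChar (f x)) ^ 2 =
      2 ^ Fintype.card V * ∑ z : LinearMap.ker A.mulVecLin, signChar (f z) := by
  classical
  have hcancel (a b c : ZMod 2) : signChar a * signChar (a + b + c) = signChar b * signChar c := by
    simp only [signChar_apply]
    revert a b c
    decide
  calc (∑ x, signChar (f x)) ^ 2
      = ∑ x, ∑ y, signChar (f x) * signChar (f y) := by
        rw [sq, Finset.sum_mul_sum]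
    _ = ∑ x, ∑ z, signChar (f x) * signChar (f (x + z)) :=
        Finset.sum_congr rfl fun x _ =>
          (Equiv.sum_comp (Equiv.addLeft x) fun y => signChar (f x) * signChar (f y)).symm
    _ = ∑ z, signChar (f z) * ∑ x, signChar (x ⬝ᵥ A.mulVec z) := by
        rw [Finset.sum_comm]
        simp only [hf, hcancel, Finset.mul_sum]
    _ = ∑ z, if A.mulVec z = 0 then 2 ^ Fintype.card V * signChar (f z) else 0 := by
        simp only [sum_signChar_dotProduct, mul_comm (signChar _), ite_mul, zero_mul]
    _ = 2 ^ Fintype.card V * ∑ z : LinearMap.ker A.mulVecLin, signChar (f z) := by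
        rw [← Finset.sum_filter, ← Finset.mul_sum]
        congr 1
        exact Finset.sum_subtype _ (by simp) _

/-- The restriction to the radical of a form with polarization `A`. -/
def radicalHom (hf : ∀ x y, f (x + y) = f x + f y + x ⬝ᵥ A.mulVec y) :
    LinearMap.ker A.mulVecLin →+ ZMod 2 :=
  AddMonoidHom.mk' (fun z => f z) fun x y => by
    have hy : A.mulVec y = 0 := y.2
    simp [hf, hy]

theorem sq_sum_signChar_eq (hf : ∀ x y, f (x + y) = f x + f y + x ⬝ᵥ A.mulVec y)
    [Decidable (radicalHom hf = 0)] :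
    (∑ x, signChar (f x)) ^ 2 =
      if radicalHom hf = 0 then 2 ^ (2 * Fintype.card V - A.rank) else 0 := by
  let _ : Fintype (LinearMap.ker A.mulVecLin) := Fintype.ofFinite _
  have h : ∑ z : LinearMap.ker A.mulVecLin, signChar (f z) = _ := sum_signChar_comp (radicalHom hf)
  have hr := A.rank_le_card_width
  rw [sq_sum_signChar hf, h, card_ker_mulVecLin]
  split_ifs
  · push_cast
    rw [← pow_add]
    congr 1
    omega
  · simp

theorem even_rank_of_polarization (hf : ∀ x y, f (x + y) = f x + f y + x ⬝ᵥ A.mulVec y) :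
    Even A.rank := by
  classical
  obtain ⟨l, hl⟩ := LinearMap.exists_extend ((radicalHom hf).toZModLinearMap 2)
  have hg : ∀ x y, (f + l) (x + y) = (f + l) x + (f + l) y + x ⬝ᵥ A.mulVec y := by
    intro x y
    simp only [Pi.add_apply, hf, map_add]
    ring
  have hzero : radicalHom hg = 0 := by
    ext z
    have hz : l z = f z := LinearMap.congr_fun hl z
    change f z + l z = 0
    rw [hz]
    exact CharTwo.add_self_eq_zero _
  have hsq := sq_sum_signChar_eq hg
  rw [if_pos hzero] at hsq
  have hr := A.rank_le_card_width
  have hnat := congrArg Int.natAbs hsq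
  rw [Int.natAbs_pow, Int.natAbs_pow] at hnat
  have hfac := congrArg (fun m => m.factorization 2) hnat
  simp [Nat.factorization_pow, Nat.prime_two.factorization] at hfac
  rw [Nat.even_iff]
  omega

end QuadraticForm

theorem quadForm_add {V : Type*} [Fintype V] [DecidableEq V] (G : SimpleGraph V)
    [DecidableRel G.Adj] (x y : V → ZMod 2) :
    quadForm G (x + y) = quadForm G x + quadForm G y + x ⬝ᵥ (G.adjMatrix (ZMod 2)).mulVec y := by
  have hpolar : x ⬝ᵥ (G.adjMatrix (ZMod 2)).mulVec y =
      ∑ e ∈ G.edgeFinset, Sym2.lift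
        ⟨fun i j => x i * y j + x j * y i, fun _ _ => add_comm _ _⟩ e := by
    have hdart : x ⬝ᵥ (G.adjMatrix (ZMod 2)).mulVec y = ∑ d : G.Dart, x d.fst * y d.snd := by
      simp only [dotProduct, Matrix.mulVec, SimpleGraph.adjMatrix_apply, ite_mul, one_mul,
        zero_mul, Finset.mul_sum, mul_ite, mul_zero]
      rw [← Fintype.sum_prod_type'
          (f := fun v w : V => if G.Adj v w then x v * y w else (0 : ZMod 2)),
        ← Finset.sum_filter]
      symm
      refine Finset.sum_nbij SimpleGraph.Dart.toProd (fun d _ => by simp)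
        (SimpleGraph.Dart.toProd_injective.injOn) (fun p hp => ?_) (fun d _ => rfl)
      exact ⟨⟨p, by simpa using hp⟩, by simp, rfl⟩
    rw [hdart, ← Finset.sum_fiberwise_of_maps_to (t := G.edgeFinset) (g := SimpleGraph.Dart.edge)
      (by simp)]
    refine Finset.sum_congr rfl fun e he => ?_
    induction e with
    | _ v w =>
      have hvw : G.Adj v w := by simpa using he
      let d : G.Dart := ⟨(v, w), hvw⟩
      have hfib := d.edge_fiber
      have hed : d.edge = s(v, w) := rfl
      rw [hed] at hfib
      rw [hfib, Finset.sum_pair d.symm_ne.symm]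
      rfl
  have hform (z : V → ZMod 2) : quadForm G z = ∑ e ∈ G.edgeFinset,
      Sym2.lift ⟨fun i j => z i * z j, fun a b => mul_comm (z a) (z b)⟩ e := by
    unfold quadForm
    congr!
  simp only [hpolar, hform, ← Finset.sum_add_distrib]
  refine Finset.sum_congr rfl fun e _ => ?_
  induction e with
  | _ v w =>
    simp only [Sym2.lift_mk, Pi.add_apply]
    ring

theorem sum_signChar_quadForm {V : Type*} [Fintype V] [DecidableEq V] (G : SimpleGraph V) :
    ∑ x, signChar (quadForm G x) = 2 ^ Fintype.card V - 2 * (msNumber G : ℤ) := by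
  classical
  have hval (a : ZMod 2) : signChar a = 1 - 2 * if a = 1 then 1 else 0 := by
    rw [signChar_apply]
    revert a
    decide
  simp only [hval, Finset.sum_sub_distrib, ← Finset.mul_sum, Finset.sum_boole]
  simp only [msNumber, Finset.sum_const, Finset.card_univ, Fintype.card_fun, ZMod.card]
  simp
  congr!

theorem brank_pos {V : Type*} [Fintype V] [DecidableEq V] (G : SimpleGraph V)
    (hE : G.edgeSet.Nonempty) : 0 < brank G := by
  classical
  obtain ⟨e, he⟩ := hE
  induction e with
  | _ v w =>
    refine Nat.pos_of_ne_zero fun h => ?_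
    have hz : G.adjMatrix (ZMod 2) = 0 := by
      have hrange : Module.finrank (ZMod 2) (LinearMap.range
          (G.adjMatrix (ZMod 2)).mulVecLin) = 0 := by
        rw [← h]
        unfold brank Matrix.rank
        congr!
      rw [Submodule.finrank_eq_zero, LinearMap.range_eq_bot] at hrange
      ext i j
      simpa using congrFun (LinearMap.congr_fun hrange (Pi.single j 1)) i
    have hvw := congrFun (congrFun hz v) w
    rw [SimpleGraph.mem_edgeSet] at he
    simp [he] at hvw

theorem msNumber_trichotomy {n : ℕ} (G : SimpleGraph (Fin n))
    (hE : G.edgeSet.Nonempty) (r : ℕ) (hr : brank G = r) :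
    Even r ∧ 0 < r ∧
      ((msNumber G = 2 ^ (n - 1) ∧
          msNumber G ≠ 2 ^ (n - 1) - 2 ^ (n - 1 - r / 2) ∧
          msNumber G ≠ 2 ^ (n - 1) + 2 ^ (n - 1 - r / 2)) ∨
       (msNumber G = 2 ^ (n - 1) - 2 ^ (n - 1 - r / 2) ∧
          msNumber G ≠ 2 ^ (n - 1) ∧
          msNumber G ≠ 2 ^ (n - 1) + 2 ^ (n - 1 - r / 2)) ∨
       (msNumber G = 2 ^ (n - 1) + 2 ^ (n - 1 - r / 2) ∧
          msNumber G ≠ 2 ^ (n - 1) ∧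
          msNumber G ≠ 2 ^ (n - 1) - 2 ^ (n - 1 - r / 2))) := by
  classical
  have hrank : (G.adjMatrix (ZMod 2)).rank = r := by
    rw [← hr]
    unfold brank
    congr!
  have heven : Even r := hrank ▸ even_rank_of_polarization (quadForm_add G)
  have hpos : 0 < r := hr ▸ brank_pos G hE
  have hle : r ≤ n := by
    simpa [hrank] using (G.adjMatrix (ZMod 2)).rank_le_card_width
  refine ⟨heven, hpos, ?_⟩
  have hsq := sq_sum_signChar_eq (quadForm_add G)
  rw [sum_signChar_quadForm, hrank, Fintype.card_fin] at hsq
  obtain ⟨k, rfl⟩ := heven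
  rw [show (k + k) / 2 = k by omega]
  have hn : (2 : ℤ) ^ n = 2 * 2 ^ (n - 1) := by
    rw [← pow_succ']
    congr 1
    omega
  have hnk : (2 : ℤ) ^ (2 * n - (k + k)) = (2 * 2 ^ (n - 1 - k)) ^ 2 := by
    rw [← pow_succ', ← pow_mul]
    congr 1
    omega
  rw [hn, hnk] at hsq
  have hlt : 2 ^ (n - 1 - k) ≤ 2 ^ (n - 1) := Nat.pow_le_pow_right two_pos (Nat.sub_le _ _)
  have hpow : 0 < 2 ^ (n - 1 - k) := by positivity
  have hcases : (msNumber G : ℤ) = 2 ^ (n - 1) ∨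
      (msNumber G : ℤ) = 2 ^ (n - 1) - 2 ^ (n - 1 - k) ∨
      (msNumber G : ℤ) = 2 ^ (n - 1) + 2 ^ (n - 1 - k) := by
    split_ifs at hsq
    · rcases sq_eq_sq_iff_eq_or_eq_neg.mp hsq with h | h
      · right; left; linarith
      · right; right; linarith
    · left
      have := pow_eq_zero_iff two_ne_zero |>.mp hsq
      linarith
  have hcast1 : ((2 ^ (n - 1) : ℕ) : ℤ) = 2 ^ (n - 1) := by push_cast; rfl
  have hcast2 : ((2 ^ (n - 1 - k) : ℕ) : ℤ) = 2 ^ (n - 1 - k) := by push_cast; rfl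
  rw [← hcast1, ← hcast2] at hcases
  generalize 2 ^ (n - 1) = a at *
  generalize 2 ^ (n - 1 - k) = b at *
  omega
end

section
/- Let G be a bipartite finite simple graph on n vertices with binary rank m. Then there exists an m×n matrix T over F₂ of rank m such that for every x ∈ F₂^n, writing y = T·x, one has f_G(x) = y₁y₂ + y₃y₄ + … + y_{m-1}y_m; that is, the quadratic form of a bipartite graph is equivalent under a nonsingular linear substitution to a readonce form of Type II with z = 0. -/
/-- A matrix over a field factors through a space of dimension its rank. -/
theorem Matrix.exists_mul_eq_of_rank {K m n : Type*} [Field K] [Fintype m] [Fintype n]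
    (M : Matrix m n K) :
    ∃ (P : Matrix m (Fin M.rank) K) (Q : Matrix (Fin M.rank) n K), P * Q = M := by
  classical
  let e : LinearMap.range M.mulVecLin ≃ₗ[K] (Fin M.rank → K) :=
    (Module.finBasis K (LinearMap.range M.mulVecLin)).equivFun
  refine ⟨LinearMap.toMatrix' ((LinearMap.range M.mulVecLin).subtype ∘ₗ e.symm.toLinearMap),
    LinearMap.toMatrix' (e.toLinearMap ∘ₗ M.mulVecLin.rangeRestrict), ?_⟩
  rw [← LinearMap.toMatrix'_comp]
  apply Matrix.toLin'.injective
  ext v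
  simp

open scoped Matrix in
/-- If the nonzero entries of `M` lie in rows indexed by `A` and columns indexed by its complement,
then `M + Mᵀ` has rank at least twice the rank of `M`. -/
theorem Matrix.rank_add_rank_le_rank_add_transpose {K n : Type*} [Field K] [Fintype n]
    (A : Set n) (M : Matrix n n K) (hM : ∀ i j, M i j ≠ 0 → i ∈ A ∧ j ∉ A) :
    M.rank + M.rank ≤ (M + Mᵀ).rank := by
  classical
  have hrow : ∀ i j, i ∉ A → M i j = 0 := fun i j hi => by
    by_contra h; exact hi (hM i j h).1
  have hcol : ∀ i j, j ∈ A → M i j = 0 := fun i j hj => by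
    by_contra h; exact (hM i j h).2 hj
  have hdisj : Disjoint (LinearMap.range M.mulVecLin) (LinearMap.range Mᵀ.mulVecLin) := by
    rw [Submodule.disjoint_def]
    rintro _ ⟨v, rfl⟩ ⟨w, hw⟩
    ext i
    by_cases hi : i ∈ A
    · rw [← hw]
      simp [Matrix.vecMul, dotProduct, hcol _ _ hi]
    · simp [Matrix.mulVec, dotProduct, hrow _ _ hi]
  have hle : LinearMap.range M.mulVecLin ⊔ LinearMap.range Mᵀ.mulVecLin ≤
      LinearMap.range (M + Mᵀ).mulVecLin := by
    refine sup_le ?_ ?_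
    · rintro _ ⟨v, rfl⟩
      refine ⟨fun j => if j ∈ A then 0 else v j, ?_⟩
      ext i
      simp only [Matrix.mulVecLin_apply, Matrix.mulVec, dotProduct]
      refine Finset.sum_congr rfl fun j _ => ?_
      by_cases hj : j ∈ A <;> simp [hj, hcol i j, hrow j i]
    · rintro _ ⟨v, rfl⟩
      refine ⟨fun j => if j ∈ A then v j else 0, ?_⟩
      ext i
      simp only [Matrix.mulVecLin_apply, Matrix.mulVec, dotProduct]
      refine Finset.sum_congr rfl fun j _ => ?_
      by_cases hj : j ∈ A <;> simp [hj, hcol i j, hrow j i]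
  calc M.rank + M.rank = M.rank + Mᵀ.rank := by rw [Matrix.rank_transpose]
    _ = Module.finrank K
        ↥(LinearMap.range M.mulVecLin ⊔ LinearMap.range Mᵀ.mulVecLin) := by
      have h := Submodule.finrank_sup_add_finrank_inf_eq
        (LinearMap.range M.mulVecLin) (LinearMap.range Mᵀ.mulVecLin)
      rw [hdisj.eq_bot, finrank_bot, add_zero] at h
      exact h.symm
    _ ≤ _ := Submodule.finrank_mono hle

open Classical in
/-- The part of the adjacency matrix with rows in `A`. -/
noncomputable def SimpleGraph.rowAdjMatrix {V : Type*} (G : SimpleGraph V) (A : Set V) :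
    Matrix V V (ZMod 2) :=
  Matrix.of fun i j => if i ∈ A ∧ G.Adj i j then 1 else 0

open Classical in
theorem SimpleGraph.rowAdjMatrix_add_transpose {V : Type*} (G : SimpleGraph V)
    (A : Set V) (hA : ∀ u v, G.Adj u v → (u ∈ A ↔ v ∉ A)) :
    G.rowAdjMatrix A + (G.rowAdjMatrix A).transpose = G.adjMatrix (ZMod 2) := by
  ext i j
  have := hA i j
  simp only [rowAdjMatrix, Matrix.add_apply, Matrix.transpose_apply, Matrix.of_apply,
    SimpleGraph.adjMatrix_apply, G.adj_comm j i]
  by_cases h : G.Adj i j <;> by_cases hi : i ∈ A <;> by_cases hj : j ∈ A <;> simp_all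

theorem quadForm_eq_dotProduct_rowAdjMatrix {V : Type*} [Fintype V] (G : SimpleGraph V)
    (A : Set V) (hA : ∀ u v, G.Adj u v → (u ∈ A ↔ v ∉ A)) (x : V → ZMod 2) :
    quadForm G x = x ⬝ᵥ (G.rowAdjMatrix A).mulVec x := by
  classical
  have hsum : x ⬝ᵥ (G.rowAdjMatrix A).mulVec x =
      ∑ p : V × V with p.1 ∈ A ∧ G.Adj p.1 p.2, x p.1 * x p.2 := by
    rw [Finset.sum_filter, Fintype.sum_prod_type]
    simp only [dotProduct, Matrix.mulVec, SimpleGraph.rowAdjMatrix, Matrix.of_apply,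
      Finset.mul_sum]
    refine Finset.sum_congr rfl fun i _ => Finset.sum_congr rfl fun j _ => ?_
    split_ifs <;> simp
  rw [hsum]
  unfold quadForm
  symm
  refine Finset.sum_bij (fun p _ => s(p.1, p.2)) ?_ ?_ ?_ ?_
  · rintro ⟨i, j⟩ h
    simpa using (Finset.mem_filter.1 h).2.2
  · rintro ⟨i, j⟩ h ⟨k, l⟩ h' heq
    simp only [Finset.mem_filter, Finset.mem_univ, true_and] at h h'
    rcases Sym2.eq_iff.1 heq with ⟨h1, h2⟩ | ⟨h1, h2⟩
    · exact Prod.ext h1 h2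
    · simp only at h1 h2
      subst h1 h2
      exact absurd h'.1 ((hA _ _ h.2).1 h.1)
  · intro e
    induction e with
    | _ i j =>
      intro h
      have hadj : G.Adj i j := by simpa using h
      by_cases hi : i ∈ A
      · exact ⟨(i, j), by simp [hi, hadj], rfl⟩
      · have hj : j ∈ A := by
          by_contra hj
          exact hi ((hA _ _ hadj).2 hj)
        exact ⟨(j, i), by simp [hj, hadj.symm], Sym2.eq_swap⟩
  · rintro ⟨i, j⟩ _
    simp

/-- The type II form in the variables `(2k, 2k+1)`, read off pairs. -/
theorem typeII_extendVec {r : ℕ} (y : Fin r × Fin 2 → ZMod 2) :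
    typeII (r * 2) (extendVec (y ∘ finProdFinEquiv.symm)) 0 = ∑ k, y (k, 0) * y (k, 1) := by
  have h (k : Fin r) (b : Fin 2) :
      extendVec (y ∘ finProdFinEquiv.symm) (2 * (k : ℕ) + b) = y (k, b) := by
    have hk : 2 * (k : ℕ) + b < r * 2 := by omega
    have he : (⟨2 * (k : ℕ) + b, hk⟩ : Fin (r * 2)) = finProdFinEquiv (k, b) :=
      Fin.ext (by simp [add_comm])
    rw [extendVec, dif_pos hk, he, Function.comp_apply, Equiv.symm_apply_apply]
  rw [typeII, add_zero, Nat.mul_div_cancel r two_pos, Finset.sum_range]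
  exact Finset.sum_congr rfl fun k _ => congrArg₂ _ (h k 0) (h k 1)

theorem bipartite_quadForm_typeII {n : ℕ} (G : SimpleGraph (Fin n))
    (A : Set (Fin n)) (hA : ∀ u v, G.Adj u v → (u ∈ A ↔ v ∉ A))
    (m : ℕ) (hm : brank G = m) :
    ∃ T : Matrix (Fin m) (Fin n) (ZMod 2), T.rank = m ∧
      ∀ x : Fin n → ZMod 2,
        quadForm G x = typeII m (extendVec (T.mulVec x)) 0 := by
  classical
  obtain ⟨P, Q, hPQ⟩ := (G.rowAdjMatrix A).exists_mul_eq_of_rank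
  have hge := Matrix.rank_add_rank_le_rank_add_transpose A (G.rowAdjMatrix A) fun i j h => by
    have h' : i ∈ A ∧ G.Adj i j := by
      by_contra hn
      exact h (if_neg hn)
    exact ⟨h'.1, (hA _ _ h'.2).1 h'.1⟩
  have hform := quadForm_eq_dotProduct_rowAdjMatrix G A hA
  have hbrank : brank G = (G.rowAdjMatrix A + (G.rowAdjMatrix A).transpose).rank := by
    rw [G.rowAdjMatrix_add_transpose A hA]
    unfold brank
    congr!
  generalize (G.rowAdjMatrix A).rank = r at P Q hPQ hge
  let S : Matrix (Fin r × Fin 2) (Fin n) (ZMod 2) := Matrix.of fun p j => ![P j p.1, Q p.1 j] p.2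
  let R : Matrix (Fin n) (Fin r × Fin 2) (ZMod 2) := Matrix.of fun j p => ![Q p.1 j, P j p.1] p.2
  have hRS : R * S = G.rowAdjMatrix A + (G.rowAdjMatrix A).transpose := by
    rw [← hPQ]
    ext i j
    simp only [R, S, Matrix.mul_apply, Matrix.of_apply, Fintype.sum_prod_type, Fin.sum_univ_two,
      Matrix.add_apply, Matrix.transpose_apply, ← Finset.sum_add_distrib, Matrix.cons_val_zero,
      Matrix.cons_val_one]
    exact Finset.sum_congr rfl fun k _ => by ring
  have hle : brank G ≤ S.rank := by
    rw [hbrank, ← hRS]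
    exact Matrix.rank_mul_le_right R S
  have hcard : S.rank ≤ r * 2 := by
    simpa using S.rank_le_card_height
  obtain rfl : m = r * 2 := by omega
  refine ⟨S.submatrix finProdFinEquiv.symm id, ?_, fun x => ?_⟩
  · have hS : (S.submatrix finProdFinEquiv.symm (Equiv.refl _)).rank = S.rank :=
      Matrix.rank_submatrix S _ _
    exact hS.trans (by omega)
  · have hT : (S.submatrix finProdFinEquiv.symm id).mulVec x =
        S.mulVec x ∘ finProdFinEquiv.symm := rfl
    rw [hT, typeII_extendVec, hform, ← hPQ, ← Matrix.mulVec_mulVec, Matrix.dotProduct_mulVec]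
    refine Finset.sum_congr rfl fun k _ => ?_
    simp [S, Matrix.vecMul, Matrix.mulVec, dotProduct, mul_comm]
end

section
/- Let G be a bipartite finite simple graph on n vertices whose binary rank equals 2r. Then the MS-number of G is w(G) = 2^{n-1} − 2^{n-1-r}, i.e., w(G) = 2^{n-1}(1 − 2^{-r}). -/
open scoped Matrix

/-- The biadjacency matrix over `F₂` of `G` between `A` and its complement. -/
noncomputable def biadjMatrix {V : Type*} (G : SimpleGraph V) (A : Set V) :
    Matrix {i // i ∈ A} {i // i ∉ A} (ZMod 2) := by
  classical
  exact fun i j => if G.Adj i j then 1 else 0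

/-- A nonzero linear functional over `F₂` takes the value `1` on exactly half of the vectors. -/
theorem two_mul_card_dotProduct_eq_one {α : Type*} [Fintype α] [DecidableEq α]
    (c : α → ZMod 2) (hc : c ≠ 0) :
    2 * (Finset.univ.filter fun z : α → ZMod 2 => z ⬝ᵥ c = 1).card = 2 ^ Fintype.card α := by
  obtain ⟨i, hi⟩ := Function.ne_iff.mp hc
  have hi1 : c i = 1 := Fin.eq_one_of_ne_zero _ hi
  have hflip : (Finset.univ.filter fun z : α → ZMod 2 => z ⬝ᵥ c = 1).card =
      (Finset.univ.filter fun z : α → ZMod 2 => ¬ z ⬝ᵥ c = 1).card := by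
    refine Finset.card_equiv (Equiv.addRight (Pi.single i 1)) fun z => ?_
    simp only [Finset.mem_filter, Finset.mem_univ, true_and, Equiv.coe_addRight, add_dotProduct,
      single_dotProduct, hi1]
    generalize z ⬝ᵥ c = t
    revert t
    decide
  have htot := Finset.card_filter_add_card_filter_not (s := Finset.univ)
    (fun z : α → ZMod 2 => z ⬝ᵥ c = 1)
  rw [← hflip, Finset.card_univ, Fintype.card_fun, ZMod.card] at htot
  omega

theorem card_mulVec_eq_zero {α β : Type*} [Fintype α] [Fintype β] [DecidableEq β]
    (B : Matrix α β (ZMod 2)) :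
    (Finset.univ.filter fun y : β → ZMod 2 => B *ᵥ y = 0).card =
      2 ^ (Fintype.card β - B.rank) := by
  classical
  have hker : Module.finrank (ZMod 2) (LinearMap.ker B.mulVecLin) =
      Fintype.card β - B.rank := by
    have h := LinearMap.finrank_range_add_finrank_ker B.mulVecLin
    rw [Module.finrank_fintype_fun_eq_card] at h
    rw [Matrix.rank]
    omega
  have hcard := Module.card_eq_pow_finrank (K := ZMod 2) (V := LinearMap.ker B.mulVecLin)
  rw [hker, ZMod.card] at hcard
  rw [← hcard, ← Fintype.card_subtype]
  exact Fintype.card_congr (Equiv.subtypeEquivRight fun y => by simp)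

/-- The number of pairs at which the bilinear form of a matrix over `F₂` takes the value `1`. -/
theorem two_mul_card_dotProduct_mulVec_eq_one {α β : Type*} [Fintype α] [Fintype β]
    [DecidableEq α] [DecidableEq β] (B : Matrix α β (ZMod 2)) :
    2 * (Finset.univ.filter fun p : (α → ZMod 2) × (β → ZMod 2) => p.1 ⬝ᵥ B *ᵥ p.2 = 1).card =
      (2 ^ Fintype.card β - 2 ^ (Fintype.card β - B.rank)) * 2 ^ Fintype.card α := by
  have hfiber : ∀ y : β → ZMod 2,
      2 * (∑ z : α → ZMod 2, if z ⬝ᵥ B *ᵥ y = 1 then 1 else 0) =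
        if ¬ B *ᵥ y = 0 then 2 ^ Fintype.card α else 0 := by
    intro y
    by_cases h : B *ᵥ y = 0
    · simp [h]
    · rw [if_pos h, ← Finset.card_filter]
      exact two_mul_card_dotProduct_eq_one _ h
  have htot := Finset.card_filter_add_card_filter_not (s := Finset.univ)
    (fun y : β → ZMod 2 => B *ᵥ y = 0)
  rw [card_mulVec_eq_zero, Finset.card_univ, Fintype.card_fun, ZMod.card] at htot
  rw [Finset.card_filter, Fintype.sum_prod_type_right, Finset.mul_sum,
    Finset.sum_congr rfl fun y _ => hfiber y, ← Finset.sum_filter, Finset.sum_const, smul_eq_mul,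
    ← htot, Nat.add_sub_cancel_left]

theorem Matrix.rank_fromBlocks_zero_transpose {α β : Type*} [Fintype α] [Fintype β]
    [DecidableEq α] [DecidableEq β] (B : Matrix α β (ZMod 2)) :
    (Matrix.fromBlocks 0 B Bᵀ 0).rank = 2 * B.rank := by
  have hcard : (Finset.univ.filter fun v : α ⊕ β → ZMod 2 =>
        Matrix.fromBlocks 0 B Bᵀ 0 *ᵥ v = 0).card =
      (Finset.univ.filter fun z : α → ZMod 2 => Bᵀ *ᵥ z = 0).card *
        (Finset.univ.filter fun y : β → ZMod 2 => B *ᵥ y = 0).card := by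
    rw [← Finset.card_product]
    refine Finset.card_equiv (Equiv.sumArrowEquivProdArrow α β (ZMod 2)) fun v => ?_
    simp only [Finset.mem_filter, Finset.mem_univ, true_and, Finset.mem_product,
      Matrix.fromBlocks_mulVec, Matrix.zero_mulVec, zero_add, add_zero]
    rw [← Sum.elim_zero_zero, Sum.elim_eq_iff]
    exact and_comm
  rw [card_mulVec_eq_zero, card_mulVec_eq_zero, card_mulVec_eq_zero, ← pow_add,
    Nat.pow_right_inj (le_refl 2), Matrix.rank_transpose, Fintype.card_sum] at hcard
  have h₁ := (Matrix.fromBlocks 0 B Bᵀ 0).rank_le_card_width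
  have h₂ := B.rank_le_card_width
  have h₃ := B.rank_le_card_height
  rw [Fintype.card_sum] at h₁
  omega

section Bipartite

variable {V : Type*} [Fintype V] {G : SimpleGraph V} {A : Set V}

open Classical in
theorem quadForm_eq_dotProduct_biadjMatrix (hA : ∀ u v, G.Adj u v → (u ∈ A ↔ v ∉ A))
    (x : V → ZMod 2) :
    quadForm G x = (fun i : {i // i ∈ A} => x i) ⬝ᵥ
      biadjMatrix G A *ᵥ fun j : {j // j ∉ A} => x j := by
  have hpairs : ((fun i : {i // i ∈ A} => x i) ⬝ᵥ
      biadjMatrix G A *ᵥ fun j : {j // j ∉ A} => x j) =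
      ∑ p : {i // i ∈ A} × {j // j ∉ A} with G.Adj p.1 p.2, x p.1 * x p.2 := by
    rw [Finset.sum_filter, Fintype.sum_prod_type]
    simp [dotProduct, Matrix.mulVec, biadjMatrix, Finset.mul_sum]
  rw [hpairs, quadForm]
  symm
  refine Finset.sum_bij (fun p _ => s((p.1 : V), (p.2 : V))) ?_ ?_ ?_ ?_
  · intro p hp
    simpa using hp
  · rintro ⟨⟨i, hi⟩, ⟨j, hj⟩⟩ _ ⟨⟨k, hk⟩, ⟨l, hl⟩⟩ _ h
    rcases Sym2.eq_iff.mp h with ⟨h₁, h₂⟩ | ⟨h₁, h₂⟩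
    · simp_all
    · simp only at h₁
      exact absurd (h₁ ▸ hi) hl
  · intro e
    induction e with
    | _ u v =>
      intro he
      have hadj : G.Adj u v := by simpa using he
      by_cases hu : u ∈ A
      · exact ⟨⟨⟨u, hu⟩, ⟨v, (hA u v hadj).mp hu⟩⟩, by simpa using hadj, rfl⟩
      · have hv : v ∈ A := by
          by_contra hv
          exact hu ((hA u v hadj).mpr hv)
        exact ⟨⟨⟨v, hv⟩, ⟨u, hu⟩⟩, by simpa using hadj.symm, Sym2.eq_swap⟩
  · intro p _
    rfl

theorem brank_eq_two_mul_rank_biadjMatrix [DecidableEq V]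
    (hA : ∀ u v, G.Adj u v → (u ∈ A ↔ v ∉ A)) [Fintype {i // i ∉ A}] :
    brank G = 2 * (biadjMatrix G A).rank := by
  classical
  rw [brank, ← Matrix.rank_submatrix _ (Equiv.sumCompl (· ∈ A)) (Equiv.sumCompl (· ∈ A)),
    ← Matrix.rank_fromBlocks_zero_transpose]
  congr 1
  ext (⟨i, hi⟩ | ⟨i, hi⟩) (⟨j, hj⟩ | ⟨j, hj⟩)
  · simpa using fun h => (hA i j h).mp hi hj
  · simp [biadjMatrix]
  · simp [biadjMatrix, G.adj_comm]
  · simpa using fun h => hi ((hA i j h).mpr hj)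

theorem msNumber_eq_card_dotProduct_biadjMatrix [Fintype {i // i ∈ A}] [Fintype {i // i ∉ A}]
    [DecidableEq {i // i ∈ A}] [DecidableEq {i // i ∉ A}]
    (hA : ∀ u v, G.Adj u v → (u ∈ A ↔ v ∉ A)) :
    msNumber G = (Finset.univ.filter
      fun p : ({i // i ∈ A} → ZMod 2) × ({i // i ∉ A} → ZMod 2) =>
        p.1 ⬝ᵥ biadjMatrix G A *ᵥ p.2 = 1).card := by
  classical
  rw [msNumber]
  refine Finset.card_equiv (Equiv.piEquivPiSubtypeProd (· ∈ A) fun _ => ZMod 2) fun x => ?_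
  simp only [Finset.mem_filter, Finset.mem_univ, true_and]
  rw [quadForm_eq_dotProduct_biadjMatrix hA]
  simp only [Equiv.piEquivPiSubtypeProd_apply]
  convert Iff.rfl

end Bipartite

theorem msNumber_of_bipartite {n : ℕ} (G : SimpleGraph (Fin n))
    (A : Set (Fin n)) (hA : ∀ u v, G.Adj u v → (u ∈ A ↔ v ∉ A))
    (r : ℕ) (hr : brank G = 2 * r) :
    msNumber G = 2 ^ (n - 1) - 2 ^ (n - 1 - r) := by
  classical
  have hrank : (biadjMatrix G A).rank = r := by
    have h := brank_eq_two_mul_rank_biadjMatrix hA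
    omega
  have hw := two_mul_card_dotProduct_mulVec_eq_one (biadjMatrix G A)
  have hcard : Fintype.card {i // i ∉ A} + Fintype.card {i // i ∈ A} = n := by
    rw [add_comm, ← Fintype.card_sum, Fintype.card_congr (Equiv.sumCompl (· ∈ A)),
      Fintype.card_fin]
  have hβ := (biadjMatrix G A).rank_le_card_width
  have hα := (biadjMatrix G A).rank_le_card_height
  rw [← msNumber_eq_card_dotProduct_biadjMatrix hA, hrank, Nat.sub_mul, ← pow_add, ← pow_add,
    hcard] at hw
  rw [hrank] at hα hβ
  rw [show Fintype.card {i // i ∉ A} - r + Fintype.card {i // i ∈ A} = n - r by omega] at hw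
  rcases Nat.eq_zero_or_pos n with rfl | hn
  · have : r = 0 := by omega
    subst this
    simpa using hw
  · have h₁ : 2 ^ n = 2 * 2 ^ (n - 1) := (mul_pow_sub_one hn.ne' 2).symm
    have h₂ : 2 ^ (n - r) = 2 * 2 ^ (n - 1 - r) := by
      rw [← pow_succ', show n - 1 - r + 1 = n - r by omega]
    omega
end

section
/- For every finite simple graph G = (V, E), the MS-number satisfies w(G) ≥ |E|. -/
/-- The quadratic form takes the value `1` at the indicator vector of an edge. -/
theorem quadForm_indicator_edge {V : Type*} [Fintype V] [DecidableEq V] (G : SimpleGraph V)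
    {e : Sym2 V} (he : e ∈ G.edgeSet) :
    quadForm G (fun v => if v ∈ e then 1 else 0) = 1 := by
  classical
  unfold quadForm
  rw [Finset.sum_eq_single_of_mem e (SimpleGraph.mem_edgeFinset.mpr he)]
  · induction e with
    | _ a b => simp
  · intro d hd hde
    have hd' := SimpleGraph.mem_edgeFinset.mp hd
    induction d with
    | _ a b =>
      have hab : a ≠ b := SimpleGraph.Adj.ne hd'
      have hnot : ¬ (a ∈ e ∧ b ∈ e) := fun h => hde ((Sym2.mem_and_mem_iff hab).mp h).symm
      simp only [Sym2.lift_mk, mul_ite, mul_one, mul_zero]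
      split_ifs <;> tauto

theorem msNumber_ge_edge_count {V : Type*} [Fintype V] [DecidableEq V]
    (G : SimpleGraph V) [DecidableRel G.Adj] :
    G.edgeFinset.card ≤ msNumber G := by
  classical
  unfold msNumber
  refine Finset.card_le_card_of_injOn (fun e v => if v ∈ e then 1 else 0) ?_ ?_
  · intro e he
    simpa using quadForm_indicator_edge G (SimpleGraph.mem_edgeFinset.mp he)
  · intro e _ d _ h
    ext v
    have hv := congrFun h v
    by_cases h₁ : v ∈ e <;> by_cases h₂ : v ∈ d <;> simp_all
end

section
/- Let G be a finite simple graph. The MS-number w(G) is odd if and only if G has exactly two vertices and at least one edge (i.e., G is the path P₂ on two vertices). Consequently, for every graph other than P₂, w(G) is even. -/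
/-- Summed over all of `F₂^V`, the monomial `x_i x_j` with `i ≠ j` gives `1` exactly when `V`
has two elements. -/
theorem sum_mul_apply_eq_ite {V : Type*} [Fintype V] [DecidableEq V] {i j : V} (hij : i ≠ j) :
    ∑ x : V → ZMod 2, x i * x j = if Fintype.card V = 2 then 1 else 0 := by
  have hprod (x : V → ZMod 2) :
      x i * x j = ∏ v, if v ∈ ({i, j} : Finset V) then x v else 1 := by
    rw [Finset.prod_ite_mem, Finset.univ_inter, Finset.prod_pair hij]
  have hfactor (v : V) : ∑ a : ZMod 2, (if v ∈ ({i, j} : Finset V) then a else 1) =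
      if v ∈ ({i, j} : Finset V) then 1 else 0 := by
    split_ifs <;> decide
  simp_rw [hprod]
  rw [← Fintype.prod_sum (fun v (a : ZMod 2) => if v ∈ ({i, j} : Finset V) then a else 1)]
  simp_rw [hfactor, Finset.prod_ite_zero, Finset.prod_const_one]
  refine if_congr ?_ rfl rfl
  rw [← Finset.card_pair hij, eq_comm, Finset.card_eq_iff_eq_univ, Finset.eq_univ_iff_forall]
  simp

theorem natCast_msNumber {V : Type*} [Fintype V] [DecidableEq V] (G : SimpleGraph V) :
    (msNumber G : ZMod 2) = ∑ x : V → ZMod 2, quadForm G x := by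
  have hite (a : ZMod 2) : (if a = 1 then 1 else 0) = a := by
    revert a
    decide
  simp only [msNumber, Finset.natCast_card_filter, hite]
  congr!

theorem natCast_msNumber_eq_ite {V : Type*} [Fintype V] (G : SimpleGraph V)
    [Decidable (Fintype.card V = 2 ∧ G.edgeSet.Nonempty)] :
    (msNumber G : ZMod 2) = if Fintype.card V = 2 ∧ G.edgeSet.Nonempty then 1 else 0 := by
  classical
  have hsum : (msNumber G : ZMod 2) =
      ∑ _e ∈ G.edgeFinset, if Fintype.card V = 2 then 1 else 0 := by
    rw [natCast_msNumber]
    simp only [quadForm]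
    rw [Finset.sum_comm]
    refine Finset.sum_congr (by ext; simp) fun e he => ?_
    induction e with
    | _ i j =>
      have hij : i ≠ j := G.ne_of_adj (by simpa using he)
      simp only [Sym2.lift_mk, sum_mul_apply_eq_ite hij]
  rw [hsum]
  by_cases hcard : Fintype.card V = 2
  · have hle : G.edgeFinset.card ≤ 1 := by
      simpa [hcard] using G.card_edgeFinset_le_card_choose_two
    by_cases hne : G.edgeSet.Nonempty
    · have hpos : 0 < G.edgeFinset.card :=
        Finset.card_pos.mpr (SimpleGraph.edgeFinset_nonempty.mpr
          (SimpleGraph.edgeSet_nonempty.mp hne))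
      simp [hcard, hne, le_antisymm hle hpos]
    · simp [hne, Finset.card_eq_zero.mpr (SimpleGraph.edgeFinset_eq_empty.mpr
        (SimpleGraph.edgeSet_eq_empty.mp (Set.not_nonempty_iff_eq_empty.mp hne)))]
  · simp [hcard]

theorem msNumber_odd_iff {V : Type*} [Fintype V] (G : SimpleGraph V) :
    (Odd (msNumber G) ↔ Fintype.card V = 2 ∧ G.edgeSet.Nonempty) ∧
      (¬(Fintype.card V = 2 ∧ G.edgeSet.Nonempty) → Even (msNumber G)) := by
  classical
  have h : Odd (msNumber G) ↔ Fintype.card V = 2 ∧ G.edgeSet.Nonempty := by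
    rw [← ZMod.natCast_eq_one_iff_odd, natCast_msNumber_eq_ite]
    simp
  exact ⟨h, fun hG => Nat.not_odd_iff_even.mp (mt h.mp hG)⟩
end

section
/- Let G be a finite simple graph of order n with at least one edge. Then w(G) ≥ 2^{n-2}. -/
/-- The mixed second difference of `quadForm G` in the directions of the two ends of an edge
is `1`. -/
theorem quadForm_second_difference {V : Type*} [Fintype V] [DecidableEq V]
    {G : SimpleGraph V} {u v : V} (h : G.Adj u v) (x : V → ZMod 2) :
    quadForm G x + quadForm G (x + Pi.single u 1) + quadForm G (x + Pi.single v 1) +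
      quadForm G (x + (Pi.single u 1 + Pi.single v 1)) = 1 := by
  classical
  unfold quadForm
  simp only [← Finset.sum_add_distrib]
  rw [Finset.sum_eq_single_of_mem s(u, v) (by simpa using h)]
  · have huv := h.ne
    simp only [Sym2.lift_mk, Pi.add_apply, Pi.single_eq_same, Pi.single_eq_of_ne huv,
      Pi.single_eq_of_ne huv.symm]
    generalize x u = a
    generalize x v = b
    revert a b
    decide
  · intro e
    induction e using Sym2.ind with
    | _ i j =>
      intro he hne
      have hij : i ≠ j := G.ne_of_adj (by simpa using he)
      have huv := h.ne
      simp only [Sym2.lift_mk, Pi.add_apply, Pi.single_apply]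
      rw [Ne, Sym2.eq_iff] at hne
      generalize x i = a
      generalize x j = b
      split_ifs <;> first
        | (exfalso; grind)
        | (clear * -; revert a b; decide)

/-- An edge `uv` yields in every coset of the span of its two indicator vectors a point where
`quadForm G` is `1`. -/
theorem two_pow_card_le_four_mul_msNumber {V : Type*} [Fintype V] (G : SimpleGraph V)
    (hE : G.edgeSet.Nonempty) : 2 ^ Fintype.card V ≤ 4 * msNumber G := by
  classical
  obtain ⟨e, he⟩ := hE
  induction e using Sym2.ind with
  | _ u v =>
    have h : G.Adj u v := he
    let T : Finset (V → ZMod 2) :=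
      {0, Pi.single u 1, Pi.single v 1, Pi.single u 1 + Pi.single v 1}
    let S : Finset (V → ZMod 2) := Finset.univ.filter fun x => quadForm G x = 1
    have hcover : (Finset.univ : Finset (V → ZMod 2)) ⊆ Finset.image₂ (· - ·) S T := by
      intro x _
      have hx : ∃ t ∈ T, quadForm G (x + t) = 1 := by
        by_contra! hne
        have zero_of_ne_one : ∀ a : ZMod 2, a ≠ 1 → a = 0 := by decide
        have h0 := zero_of_ne_one _ (hne 0 (by simp [T]))
        have hu := zero_of_ne_one _ (hne (Pi.single u 1) (by simp [T]))
        have hv := zero_of_ne_one _ (hne (Pi.single v 1) (by simp [T]))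
        have huv := zero_of_ne_one _ (hne (Pi.single u 1 + Pi.single v 1) (by simp [T]))
        rw [add_zero] at h0
        simpa [h0, hu, hv, huv] using quadForm_second_difference h x
      obtain ⟨t, ht, hxt⟩ := hx
      exact Finset.mem_image₂.2 ⟨x + t, by simpa [S] using hxt, t, ht, add_sub_cancel_right x t⟩
    calc 2 ^ Fintype.card V = (Finset.univ : Finset (V → ZMod 2)).card := by
          simp [Finset.card_univ, ZMod.card]
      _ ≤ (Finset.image₂ (· - ·) S T).card := Finset.card_le_card hcover
      _ ≤ S.card * T.card := Finset.card_image₂_le _ _ _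
      _ ≤ S.card * 4 := Nat.mul_le_mul_left _ Finset.card_le_four
      _ = 4 * msNumber G := by rw [mul_comm]; rfl

theorem msNumber_lower_bound {n : ℕ} (G : SimpleGraph (Fin n))
    (hE : G.edgeSet.Nonempty) :
    2 ^ (n - 2) ≤ msNumber G := by
  have h := two_pow_card_le_four_mul_msNumber G hE
  rw [Fintype.card_fin] at h
  have hn : 2 ≤ n := by
    obtain ⟨e, he⟩ := hE
    induction e using Sym2.ind with
    | _ u v =>
      have huv : u ≠ v := G.ne_of_adj he
      omega
  obtain ⟨m, rfl⟩ := Nat.exists_eq_add_of_le' hn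
  rw [pow_add] at h
  rw [Nat.add_sub_cancel]
  omega
end

section
/- For n ≥ 4, let Q_n be the disjoint union of the complete graph K₄ on 4 vertices with the empty graph on n − 4 vertices. Then w(Q_n) = 2^{n-1} + 2^{n-3}; in particular Q_n attains the maximum MS-number among all graphs of order n. -/
theorem Fintype.card_eq_two_mul_card_filter_eq_zero {M : Type*} [AddCommGroup M] [Fintype M]
    {f : M → ZMod 2} {c : M} (hf : ∀ x, f (x + c) = f x + 1) :
    Fintype.card M = 2 * (Finset.univ.filter fun x => f x = 0).card := by
  have hcard : (Finset.univ.filter fun x => f x = 0).card =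
      (Finset.univ.filter fun x => ¬ f x = 0).card := by
    refine Finset.card_equiv (Equiv.addRight c) fun x => ?_
    simp only [Finset.mem_filter, Finset.mem_univ, true_and, Equiv.coe_addRight, hf]
    generalize f x = a
    revert a
    decide
  have := Finset.card_filter_add_card_filter_not (s := (Finset.univ : Finset M))
    (fun x => f x = 0)
  rw [Finset.card_univ] at this
  omega

/-- A function of degree at most two on an elementary abelian 2-group: its third
difference at the origin vanishes. -/
def IsQuadratic {M : Type*} [AddCommGroup M] (f : M → ZMod 2) : Prop :=
  ∀ x y z, f (x + y + z) + f (x + y) + f (y + z) + f (x + z) + f x + f y + f z = 0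

theorem IsQuadratic.map_zero {M : Type*} [AddCommGroup M] {f : M → ZMod 2}
    (hf : IsQuadratic f) : f 0 = 0 := by
  have := hf 0 0 0
  simp only [add_zero] at this
  revert this
  generalize f 0 = p
  revert p
  decide

theorem IsQuadratic.card_le_four_mul {M : Type*} [AddCommGroup M] [Fintype M]
    {f : M → ZMod 2} (hf : IsQuadratic f) :
    Fintype.card M ≤ 4 * (Finset.univ.filter fun x => f x = 0).card := by
  by_cases hadd : ∀ a b, f (a + b) = f a + f b
  · by_cases hc : ∃ c, f c = 1
    · obtain ⟨c, hc⟩ := hc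
      have := Fintype.card_eq_two_mul_card_filter_eq_zero (f := f) (c := c)
        fun x => by rw [hadd, hc]
      omega
    · have hz : ∀ x, f x = 0 := fun x => by
        have key : ∀ p : ZMod 2, p ≠ 1 → p = 0 := by decide
        exact key _ fun h => hc ⟨x, h⟩
      simp only [hz, Finset.filter_true, Finset.card_univ]
      omega
  · push Not at hadd
    obtain ⟨a, b, hab⟩ := hadd
    have hshift (c : M) : ∑ x, (if f (x + c) = 0 then 1 else 0) =
        (Finset.univ.filter fun x => f x = 0).card := by
      rw [Finset.card_filter]
      exact Equiv.sum_comp (Equiv.addRight c) fun x => if f x = 0 then 1 else 0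
    have hle : ∑ _x : M, 1 ≤ ∑ x, ((if f (x + 0) = 0 then 1 else 0) +
        (if f (x + a) = 0 then 1 else 0) + (if f (x + b) = 0 then 1 else 0) +
        (if f (x + (a + b)) = 0 then 1 else 0)) := by
      refine Finset.sum_le_sum fun x _ => ?_
      have := hf x a b
      rw [add_assoc x a b] at this
      rw [add_zero]
      revert this hab
      generalize f (x + (a + b)) = p
      generalize f (x + a) = q
      generalize f (x + b) = r
      generalize f (a + b) = s
      generalize f x = t
      generalize f a = u
      generalize f b = v
      revert p q r s t u v
      decide
    simp only [Finset.sum_add_distrib, hshift, Finset.sum_const, Finset.card_univ,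
      smul_eq_mul, mul_one] at hle
    omega

theorem IsQuadratic.three_mul_card_le {M : Type*} [AddCommGroup M] [Fintype M]
    {f : M → ZMod 2} (hf : IsQuadratic f) (h2 : ∀ x : M, x + x = 0)
    {u v : M} (hv : f v = 0) (huv : f (u + v) ≠ f u) :
    3 * Fintype.card M ≤ 8 * (Finset.univ.filter fun x => f x = 0).card := by
  let l : M →+ ZMod 2 := AddMonoidHom.mk' (fun x => f (x + v) + f x) fun x y => by
    have := hf x y v
    rw [hv] at this
    revert this
    generalize f (x + y + v) = p
    generalize f (x + y) = q
    generalize f (x + v) = r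
    generalize f (y + v) = s
    generalize f x = t
    generalize f y = w
    revert p q r s t w
    decide
  have hl (x : M) : l x = f (x + v) + f x := rfl
  have hlv : l v = 0 := by rw [hl, h2, hf.map_zero, hv, add_zero]
  have hlu : l u = 1 := by
    rw [hl]
    revert huv
    generalize f (u + v) = p
    generalize f u = q
    revert p q
    decide
  have hker := Fintype.card_eq_two_mul_card_filter_eq_zero (f := l) (c := u)
    fun x => by rw [map_add, hlu]
  have hcardker : Fintype.card {x // l x = 0} = (Finset.univ.filter fun x => l x = 0).card :=
    Fintype.card_subtype _
  have hW : Fintype.card {x // l x = 0} ≤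
      4 * (Finset.univ.filter fun x => l x = 0 ∧ f x = 0).card := by
    have hq : IsQuadratic fun x : l.ker => f x := fun x y z => hf x y z
    have : Fintype l.ker := inferInstanceAs (Fintype {x // l x = 0})
    have h := hq.card_le_four_mul
    have hc : (Finset.univ.filter fun x : l.ker => f x = 0).card =
        (Finset.univ.filter fun x => l x = 0 ∧ f x = 0).card := by
      rw [← Finset.card_map (Function.Embedding.subtype fun x => x ∈ l.ker)]
      congr 1
      ext x
      simp [AddMonoidHom.mem_ker, and_comm]
    rw [hc] at h
    convert h using 1
    exact Fintype.card_congr (Equiv.refl l.ker)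
  have hflip : (Finset.univ.filter fun x => l x = 1 ∧ f x = 0).card =
      (Finset.univ.filter fun x => l x = 1 ∧ f x = 1).card := by
    refine Finset.card_equiv (Equiv.addRight v) fun x => ?_
    simp only [Finset.mem_filter, Finset.mem_univ, true_and, Equiv.coe_addRight, map_add, hlv,
      add_zero]
    rw [hl]
    generalize f (x + v) = p
    generalize f x = q
    revert p q
    decide
  have key : ∀ p q : ZMod 2, (if p = 1 ∧ q = 0 then 1 else 0) +
      (if p = 1 ∧ q = 1 then 1 else 0) + (if p = 0 then 1 else 0) = 1 ∧
      (if q = 0 then 1 else 0) = (if p = 0 ∧ q = 0 then 1 else 0) +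
        (if p = 1 ∧ q = 0 then 1 else 0) := by decide
  have hsum : (Finset.univ.filter fun x => l x = 1 ∧ f x = 0).card +
      (Finset.univ.filter fun x => l x = 1 ∧ f x = 1).card +
      (Finset.univ.filter fun x => l x = 0).card = Fintype.card M := by
    simp only [Finset.card_filter, ← Finset.sum_add_distrib, (key _ _).1]
    simp
  have hzero : (Finset.univ.filter fun x => f x = 0).card =
      (Finset.univ.filter fun x => l x = 0 ∧ f x = 0).card +
      (Finset.univ.filter fun x => l x = 1 ∧ f x = 0).card := by
    simp only [Finset.card_filter, ← Finset.sum_add_distrib]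
    exact Finset.sum_congr rfl fun x _ => (key (l x) (f x)).2
  omega

section QuadForm

variable {V : Type*} [Fintype V] (G : SimpleGraph V)

theorem quadForm_isQuadratic : IsQuadratic (quadForm G) := by
  intro x y z
  simp only [quadForm, ← Finset.sum_add_distrib]
  refine Finset.sum_eq_zero fun e _ => ?_
  induction e with
  | _ i j =>
    have key : ∀ a b c d p q : ZMod 2, (a + c + p) * (b + d + q) + (a + c) * (b + d) +
        (c + p) * (d + q) + (a + p) * (b + q) + a * b + c * d + p * q = 0 := by decide
    exact key _ _ _ _ _ _

theorem quadForm_single [DecidableEq V] (v : V) : quadForm G (Pi.single v 1) = 0 := by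
  classical
  simp only [quadForm]
  refine Finset.sum_eq_zero fun e he => ?_
  induction e with
  | _ i j =>
    have hij : i ≠ j := (SimpleGraph.mem_edgeFinset.mp he : G.Adj i j).ne
    simp only [Sym2.lift_mk, Pi.single_apply]
    grind

theorem quadForm_single_add_single [DecidableEq V] {u v : V} (h : G.Adj u v) :
    quadForm G (Pi.single u 1 + Pi.single v 1) = 1 := by
  classical
  simp only [quadForm]
  rw [Finset.sum_eq_single s(u, v)]
  · simp [Pi.single_apply, h.ne, h.ne.symm]
  · intro e he hne
    induction e with
    | _ i j =>
      have hij : i ≠ j := (SimpleGraph.mem_edgeFinset.mp he : G.Adj i j).ne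
      simp only [Sym2.lift_mk, Pi.add_apply, Pi.single_apply, ne_eq, Sym2.eq_iff] at hne ⊢
      grind
  · intro hn
    exact absurd (SimpleGraph.mem_edgeFinset.mpr h) hn

theorem msNumber_add_card_filter_eq_zero [DecidableEq V] :
    msNumber G + (Finset.univ.filter fun x => quadForm G x = 0).card = 2 ^ Fintype.card V := by
  have key : ∀ p : ZMod 2, (if p = 1 then 1 else 0) + (if p = 0 then 1 else 0) = 1 := by decide
  have hms : msNumber G = (Finset.univ.filter fun x => quadForm G x = 1).card := by
    simp only [msNumber]
    congr!
  rw [hms, Finset.card_filter, Finset.card_filter, ← Finset.sum_add_distrib]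
  simp [key, ZMod.card]

theorem eight_mul_msNumber_le : 8 * msNumber G ≤ 5 * 2 ^ Fintype.card V := by
  classical
  have hadd := msNumber_add_card_filter_eq_zero G
  by_cases h : ∃ u v, G.Adj u v
  · obtain ⟨u, v, h⟩ := h
    have := (quadForm_isQuadratic G).three_mul_card_le
      (fun x => funext fun i => CharTwo.add_self_eq_zero (x i)) (u := Pi.single u 1) (v := Pi.single v 1)
      (quadForm_single G v)
      (by rw [quadForm_single_add_single G h, quadForm_single]; decide)
    rw [Fintype.card_fun, ZMod.card] at this
    omega
  · have hz (x : V → ZMod 2) : quadForm G x = 0 := by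
      simp only [quadForm]
      refine Finset.sum_eq_zero fun e he => ?_
      induction e with
      | _ i j => exact absurd ⟨i, j, SimpleGraph.mem_edgeFinset.mp he⟩ h
    have : msNumber G = 0 := by simp [msNumber, hz]
    omega

theorem quadForm_sum_bot {W : Type*} [Fintype W] (x : V ⊕ W → ZMod 2) :
    quadForm (G ⊕g (⊥ : SimpleGraph W)) x = quadForm G (x ∘ Sum.inl) := by
  classical
  simp only [quadForm]
  symm
  refine Finset.sum_bij (fun e _ => e.map Sum.inl) ?_ ?_ ?_ ?_
  · intro e he
    induction e with
    | _ i j => simpa using he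
  · intro e _ e' _ h
    exact Sym2.map.injective Sum.inl_injective h
  · intro e he
    induction e with
    | _ i j =>
      rcases i with i | i <;> rcases j with j | j <;> simp at he
      exact ⟨s(i, j), by simpa using he, rfl⟩
  · intro e _
    induction e with
    | _ i j => rfl

theorem msNumber_sum_bot {W : Type*} [Fintype W] :
    msNumber (G ⊕g (⊥ : SimpleGraph W)) = msNumber G * 2 ^ Fintype.card W := by
  classical
  have : msNumber (G ⊕g (⊥ : SimpleGraph W)) =
      ((Finset.univ.filter fun x : V → ZMod 2 => quadForm G x = 1) ×ˢ
        (Finset.univ : Finset (W → ZMod 2))).card := by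
    simp only [msNumber]
    refine Finset.card_equiv (Equiv.sumArrowEquivProdArrow V W (ZMod 2)) fun x => ?_
    simp only [Finset.mem_filter, Finset.mem_univ, true_and, quadForm_sum_bot,
      Finset.mem_product, and_true]
    rfl
  rw [this, Finset.card_product, Finset.card_univ, Fintype.card_fun, ZMod.card]
  simp [msNumber]

end QuadForm

theorem quadForm_top_fin_four (x : Fin 4 → ZMod 2) : quadForm (⊤ : SimpleGraph (Fin 4)) x =
    x 0 * x 1 + x 0 * x 2 + x 0 * x 3 + x 1 * x 2 + x 1 * x 3 + x 2 * x 3 := by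
  have : (⊤ : SimpleGraph (Fin 4)).edgeFinset =
      {s(0, 1), s(0, 2), s(0, 3), s(1, 2), s(1, 3), s(2, 3)} := by decide
  simp only [quadForm]
  trans ∑ e ∈ ({s(0, 1), s(0, 2), s(0, 3), s(1, 2), s(1, 3), s(2, 3)} : Finset (Sym2 (Fin 4))),
    Sym2.lift ⟨fun i j => x i * x j, fun a b => mul_comm (x a) (x b)⟩ e
  · rw [← this]
    congr!
  · rw [Finset.sum_insert (by decide), Finset.sum_insert (by decide),
      Finset.sum_insert (by decide), Finset.sum_insert (by decide),
      Finset.sum_insert (by decide), Finset.sum_singleton]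
    simp only [Sym2.lift_mk]
    ring

theorem msNumber_top_fin_four : msNumber (⊤ : SimpleGraph (Fin 4)) = 10 := by
  simp only [msNumber, quadForm_top_fin_four]
  trans (Finset.univ.filter fun x : Fin 4 → ZMod 2 =>
    x 0 * x 1 + x 0 * x 2 + x 0 * x 3 + x 1 * x 2 + x 1 * x 3 + x 2 * x 3 = 1).card
  · congr!
  · decide

theorem msNumber_Qn {n : ℕ} (hn : 4 ≤ n) :
    msNumber ((⊤ : SimpleGraph (Fin 4)) ⊕g (⊥ : SimpleGraph (Fin (n - 4)))) =
        2 ^ (n - 1) + 2 ^ (n - 3) ∧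
      ∀ G : SimpleGraph (Fin n),
        msNumber G ≤
          msNumber ((⊤ : SimpleGraph (Fin 4)) ⊕g (⊥ : SimpleGraph (Fin (n - 4)))) := by
  have hQ : msNumber ((⊤ : SimpleGraph (Fin 4)) ⊕g (⊥ : SimpleGraph (Fin (n - 4)))) =
      2 ^ (n - 1) + 2 ^ (n - 3) := by
    rw [msNumber_sum_bot, msNumber_top_fin_four, Fintype.card_fin]
    obtain ⟨m, rfl⟩ := Nat.exists_eq_add_of_le' hn
    rw [show m + 4 - 4 = m by omega, show m + 4 - 1 = m + 3 by omega,
      show m + 4 - 3 = m + 1 by omega]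
    ring
  refine ⟨hQ, fun G => ?_⟩
  rw [hQ]
  have h := eight_mul_msNumber_le G
  rw [Fintype.card_fin] at h
  obtain ⟨m, rfl⟩ := Nat.exists_eq_add_of_le' hn
  rw [show m + 4 - 1 = m + 3 by omega, show m + 4 - 3 = m + 1 by omega]
  rw [pow_add] at h ⊢
  rw [pow_succ]
  omega
end

section
/- For every integer n ≥ 1, the complete graph K_n satisfies w(K_n) = Σ_{i=0}^{⌊(n-1)/4⌋} C(n+1, 4i+3), where C(·,·) denotes the binomial coefficient. -/
theorem quadForm_top {V : Type*} [Fintype V] (x : V → ZMod 2) :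
    quadForm (⊤ : SimpleGraph V) x = ((Finset.univ.filter fun i => x i = 1).card.choose 2 : ℕ) := by
  classical
  set s := Finset.univ.filter fun i => x i = 1 with hs
  have hmul : ∀ a b : ZMod 2, a * b = if a = 1 ∧ b = 1 then 1 else 0 := by decide
  rw [← Sym2.card_image_offDiag, quadForm]
  trans ∑ e ∈ (⊤ : SimpleGraph V).edgeFinset,
      if e ∈ s.offDiag.image Sym2.mk.uncurry then (1 : ZMod 2) else 0
  · refine Finset.sum_congr (by congr!) fun e he => ?_
    induction e with
    | h a b =>
      have hab : a ≠ b := by simpa using he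
      rw [Sym2.lift_mk]
      refine (hmul _ _).trans ?_
      refine if_congr ?_ rfl rfl
      simp only [Finset.mem_image, Finset.mem_offDiag, hs, Finset.mem_filter, Finset.mem_univ,
        true_and, Prod.exists, Function.uncurry, Sym2.eq_iff]
      grind
  · rw [Finset.sum_boole]
    congr 2
    ext e
    induction e with
    | h a b =>
      simp only [Finset.mem_filter, SimpleGraph.mem_edgeFinset, SimpleGraph.mem_edgeSet,
        SimpleGraph.top_adj, Finset.mem_image, Finset.mem_offDiag, Prod.exists,
        Function.uncurry, Sym2.eq_iff]
      grind

theorem msNumber_top {V : Type*} [Fintype V] :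
    msNumber (⊤ : SimpleGraph V) = ∑ k ∈ Finset.range (Fintype.card V + 1),
      if Odd (k.choose 2) then (Fintype.card V).choose k else 0 := by
  classical
  have hsum := Finset.sum_powerset_apply_card (x := (Finset.univ : Finset V))
    (fun k => if Odd (k.choose 2) then 1 else 0)
  simp only [smul_eq_mul, mul_ite, mul_one, mul_zero, Finset.card_univ] at hsum
  rw [← hsum, ← Finset.card_filter, msNumber]
  have hz : ∀ a : ZMod 2, a ≠ 1 → a = 0 := by decide
  refine Finset.card_bij' (fun x _ => Finset.univ.filter fun i => x i = 1)
    (fun s _ i => if i ∈ s then 1 else 0) ?_ ?_ ?_ ?_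
  · intro x hx
    simpa [quadForm_top, ZMod.natCast_eq_one_iff_odd] using hx
  · intro s hs
    simpa [quadForm_top, ZMod.natCast_eq_one_iff_odd] using hs
  · intro x _
    ext i
    by_cases h : x i = 1
    · simp [h]
    · simp [hz _ h]
  · intro s _
    ext i
    simp

theorem Nat.odd_choose_two_iff (k : ℕ) : Odd (k.choose 2) ↔ k % 4 = 2 ∨ k % 4 = 3 := by
  suffices h : k.choose 2 % 2 = (k % 4) / 2 by
    rw [Nat.odd_iff]
    omega
  induction k with
  | zero => rfl
  | succ k ih =>
    rw [Nat.choose_succ_succ' k 1, Nat.choose_one_right, one_add_one_eq_two]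
    have hk : k % 4 < 4 := Nat.mod_lt _ (by norm_num)
    rw [Nat.add_mod k, ih, Nat.add_mod k 1 4, ← Nat.mod_mod_of_dvd k (show 2 ∣ 4 by norm_num)]
    interval_cases k % 4 <;> rfl

theorem sum_range_odd_choose_two (n m : ℕ) :
    (∑ k ∈ Finset.range (4 * m), if Odd (k.choose 2) then n.choose k else 0) =
      ∑ i ∈ Finset.range m, (n + 1).choose (4 * i + 3) := by
  simp only [Nat.odd_choose_two_iff]
  induction m with
  | zero => rfl
  | succ m ih =>
    rw [Finset.sum_range_succ, ← ih, Nat.mul_succ]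
    simp [Finset.sum_range_succ, Nat.choose_succ_succ', add_assoc, Nat.add_mod]

theorem msNumber_complete {n : ℕ} (hn : 1 ≤ n) :
    msNumber (⊤ : SimpleGraph (Fin n)) =
      ∑ i ∈ Finset.range ((n - 1) / 4 + 1), (n + 1).choose (4 * i + 3) := by
  rw [msNumber_top, Fintype.card_fin]
  trans ∑ i ∈ Finset.range (n / 4 + 1), (n + 1).choose (4 * i + 3)
  · rw [← sum_range_odd_choose_two]
    refine Finset.sum_subset (Finset.range_mono (by omega)) fun k _ hk => ?_
    rw [Finset.mem_range] at hk
    rw [Nat.choose_eq_zero_of_lt (show n < k by omega), ite_self]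
  · refine (Finset.sum_subset (Finset.range_mono (by omega)) fun i _ hi => ?_).symm
    rw [Finset.mem_range] at hi
    exact Nat.choose_eq_zero_of_lt (by omega)
end

section
/- For every integer n ≥ 1, the path graph P_n on n vertices satisfies: w(P_n) = 2^{n-1} − 2^{(n-1)/2} if n is odd, and w(P_n) = 2^{n-1} − 2^{(n-2)/2} if n is even. -/
/-- The quadratic form of the path on `n + 1` vertices, as a sum over consecutive pairs. -/
def pathForm {n : ℕ} (x : Fin (n + 1) → ZMod 2) : ZMod 2 :=
  ∑ i : Fin n, x i.castSucc * x i.succ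

theorem quadForm_pathGraph_succ {n : ℕ} (x : Fin (n + 1) → ZMod 2) :
    quadForm (SimpleGraph.pathGraph (n + 1)) x = pathForm x := by
  classical
  unfold quadForm pathForm
  symm
  refine Finset.sum_bij (fun i _ => s(i.castSucc, i.succ)) ?_ ?_ ?_ ?_
  · intro i _
    simp [SimpleGraph.pathGraph_adj]
  · intro i _ j _ h
    rw [Sym2.eq_iff] at h
    simp only [Fin.ext_iff, Fin.val_castSucc, Fin.val_succ] at h ⊢
    omega
  · intro e
    induction e using Sym2.ind with
    | _ a b =>
      intro h
      rw [SimpleGraph.mem_edgeFinset, SimpleGraph.mem_edgeSet, SimpleGraph.pathGraph_adj] at h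
      rcases h with h | h
      · refine ⟨⟨a, by omega⟩, Finset.mem_univ _,
          Sym2.eq_iff.2 (Or.inl ⟨rfl, Fin.ext h⟩)⟩
      · refine ⟨⟨b, by omega⟩, Finset.mem_univ _,
          Sym2.eq_iff.2 (Or.inr ⟨rfl, Fin.ext h⟩)⟩
  · intro i _
    rfl

theorem pathForm_cons {n : ℕ} (a : ZMod 2) (y : Fin (n + 1) → ZMod 2) :
    pathForm (Fin.cons a y : Fin (n + 2) → ZMod 2) = a * y 0 + pathForm y := by
  simp [pathForm, Fin.sum_univ_succ]

/-- The nontrivial additive character of `ZMod 2`, with values in `ℤ`. -/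
def binarySign (z : ZMod 2) : ℤ := if z = 1 then -1 else 1

theorem sum_fin_succ_pi {M : Type*} [AddCommMonoid M] {n : ℕ}
    (g : (Fin (n + 1) → ZMod 2) → M) :
    ∑ x, g x = ∑ y : Fin n → ZMod 2, (g (Fin.cons 0 y) + g (Fin.cons 1 y)) := by
  rw [← (Fin.consEquiv fun _ : Fin (n + 1) => ZMod 2).sum_comp, Fintype.sum_prod_type,
    Finset.sum_comm]
  exact Finset.sum_congr rfl fun y _ => Fin.sum_univ_two _

/-- The character sum of the path form on `n + 1` vertices. -/
def pathSum (n : ℕ) : ℤ := ∑ x : Fin (n + 1) → ZMod 2, binarySign (pathForm x)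

theorem pathSum_add_two (n : ℕ) : pathSum (n + 2) = 2 * pathSum n := by
  unfold pathSum
  rw [sum_fin_succ_pi, sum_fin_succ_pi, Finset.mul_sum]
  refine Finset.sum_congr rfl fun z _ => ?_
  simp only [pathForm_cons, Fin.cons_zero]
  generalize z 0 = a
  generalize pathForm z = b
  revert a b
  decide

theorem pathSum_two_mul (k : ℕ) : pathSum (2 * k) = 2 ^ (k + 1) := by
  induction k with
  | zero => decide
  | succ k ih => rw [mul_add, mul_one, pathSum_add_two, ih, pow_succ _ (k + 1), mul_comm]

theorem pathSum_two_mul_add_one (k : ℕ) : pathSum (2 * k + 1) = 2 ^ (k + 1) := by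
  induction k with
  | zero => decide
  | succ k ih =>
    rw [show 2 * (k + 1) + 1 = 2 * k + 1 + 2 by ring, pathSum_add_two, ih, pow_succ _ (k + 1),
      mul_comm]

theorem two_mul_msNumber_path_succ (n : ℕ) :
    2 * (msNumber (SimpleGraph.pathGraph (n + 1)) : ℤ) = 2 ^ (n + 1) - pathSum n := by
  have sign_eq (z : ZMod 2) : binarySign z = 1 - 2 * (if z = 1 then 1 else 0) := by
    revert z; decide
  simp only [msNumber, quadForm_pathGraph_succ, pathSum, sign_eq, Finset.sum_sub_distrib,
    ← Finset.mul_sum, Finset.sum_boole]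
  simp
  congr!

theorem msNumber_path {n : ℕ} (hn : 1 ≤ n) :
    (Odd n → msNumber (SimpleGraph.pathGraph n) = 2 ^ (n - 1) - 2 ^ ((n - 1) / 2)) ∧
      (Even n → msNumber (SimpleGraph.pathGraph n) = 2 ^ (n - 1) - 2 ^ ((n - 2) / 2)) := by
  obtain ⟨m, rfl⟩ := Nat.exists_eq_add_of_le' hn
  have h := two_mul_msNumber_path_succ m
  constructor
  · rintro ⟨k, hk⟩
    obtain rfl : m = 2 * k := by omega
    rw [pathSum_two_mul, pow_succ, pow_succ] at h
    rw [Nat.add_sub_cancel, Nat.mul_div_cancel_left k two_pos]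
    zify [Nat.pow_le_pow_right two_pos (show k ≤ 2 * k by omega)]
    linarith
  · rintro ⟨k, hk⟩
    obtain ⟨j, rfl⟩ : ∃ j, m = 2 * j + 1 := ⟨k - 1, by omega⟩
    rw [pathSum_two_mul_add_one, pow_succ, pow_succ _ j] at h
    rw [Nat.add_sub_cancel, show (2 * j + 1 + 1 - 2) / 2 = j by omega]
    zify [Nat.pow_le_pow_right two_pos (show j ≤ 2 * j + 1 by omega)]
    linarith
end
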